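/- arXiv:1901.00852 — 3 statements merged into one kernel-verified Lean document; each statement's English description precedes it below -/
import Mathlib

section
/- Bernstein approximation error bound under a Lipschitz condition: Let f : [0,1]^n -> R satisfy |f(x) - f(y)| <= L * ||x - y||_2 for all x, y in [0,1]^n, where ||.||_2 is the Euclidean norm. Then for all positive integers m_1, ..., m_n and all x in [0,1]^n, |B_{m_1,...,m_n}(f)(x) - f(x)| <= (L/2) * ( sum over j = 1,...,n of 1/m_j )^{1/2}. -/
open Finset

/-- The multivariate Bernstein polynomial of `f : [0,1]ⁿ → ℝ` with degrees `m₁, …, mₙ`. -/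
noncomputable def mvBernstein {n : ℕ} (m : Fin n → ℕ) (f : (Fin n → ℝ) → ℝ)
    (x : Fin n → ℝ) : ℝ :=
  ∑ k ∈ Fintype.piFinset (fun j => Finset.range (m j + 1)),
    f (fun j => (k j : ℝ) / (m j : ℝ)) *
      ∏ j, (((m j).choose (k j) : ℝ) * x j ^ (k j) * (1 - x j) ^ (m j - k j))

/-- The weight of the node `k / m` in the Bernstein operator of degree `m`. -/
noncomputable def bernsteinWeight (m k : ℕ) (t : ℝ) : ℝ :=
  (m.choose k : ℝ) * t ^ k * (1 - t) ^ (m - k)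

lemma bernsteinWeight_nonneg (m k : ℕ) {t : ℝ} (h₀ : 0 ≤ t) (h₁ : t ≤ 1) :
    0 ≤ bernsteinWeight m k t := by
  have : 0 ≤ 1 - t := sub_nonneg.mpr h₁
  unfold bernsteinWeight
  positivity

lemma sum_bernsteinWeight (m : ℕ) (t : ℝ) :
    ∑ k ∈ Finset.range (m + 1), bernsteinWeight m k t = 1 := by
  have h := congrArg (Polynomial.eval t) (bernsteinPolynomial.sum ℝ m)
  simpa [Polynomial.eval_finsetSum, bernsteinPolynomial, bernsteinWeight] using h

lemma sum_bernsteinWeight_mul_sq {m : ℕ} (hm : 0 < m) (t : ℝ) :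
    ∑ k ∈ Finset.range (m + 1), bernsteinWeight m k t * ((k : ℝ) / m - t) ^ 2 =
      t * (1 - t) / m := by
  have h := congrArg (Polynomial.eval t) (bernsteinPolynomial.variance ℝ m)
  simp only [Polynomial.eval_finsetSum, bernsteinPolynomial, Polynomial.eval_mul,
    Polynomial.eval_pow, Polynomial.eval_sub, Polynomial.eval_X,
    Polynomial.eval_natCast, Polynomial.eval_one, nsmul_eq_mul] at h
  have hm' : (m : ℝ) ≠ 0 := by exact_mod_cast hm.ne'
  have key : (m : ℝ) ^ 2 *
      ∑ k ∈ Finset.range (m + 1), bernsteinWeight m k t * ((k : ℝ) / m - t) ^ 2 =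
      m * t * (1 - t) := by
    rw [← h, Finset.mul_sum]
    refine Finset.sum_congr rfl fun k _ => ?_
    unfold bernsteinWeight
    field_simp
    ring
  apply mul_left_cancel₀ (pow_ne_zero 2 hm')
  rw [key]
  field_simp

/-- Summing a product weight against a function of one coordinate, when the other factors have
total mass one. -/
lemma sum_piFinset_prod_mul_apply {ι α : Type*} [Fintype ι] [DecidableEq ι]
    (s : ι → Finset α) (w : ι → α → ℝ) (i : ι) (hw : ∀ j, j ≠ i → ∑ a ∈ s j, w j a = 1)
    (g : α → ℝ) :
    ∑ k ∈ Fintype.piFinset s, (∏ j, w j (k j)) * g (k i) = ∑ a ∈ s i, w i a * g a := by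
  calc ∑ k ∈ Fintype.piFinset s, (∏ j, w j (k j)) * g (k i)
      = ∑ k ∈ Fintype.piFinset s, ∏ j, w j (k j) * (if j = i then g (k j) else 1) := by
        refine Finset.sum_congr rfl fun k _ => ?_
        rw [Finset.prod_mul_distrib]
        simp
    _ = ∏ j, ∑ a ∈ s j, w j a * (if j = i then g a else 1) :=
        (Finset.prod_univ_sum s fun j a => w j a * (if j = i then g a else 1)).symm
    _ = ∑ a ∈ s i, w i a * g a := by
        rw [Finset.prod_eq_single i (fun j _ hj => by simp [hj, hw j hj]) (by simp)]
        simp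

/-- Jensen's inequality for the square root. -/
lemma sum_mul_sqrt_le_sqrt_sum_mul {κ : Type*} (s : Finset κ) (w d : κ → ℝ)
    (hw : ∀ k ∈ s, 0 ≤ w k) (hw1 : ∑ k ∈ s, w k = 1) (hd : ∀ k ∈ s, 0 ≤ d k) :
    ∑ k ∈ s, w k * √(d k) ≤ √(∑ k ∈ s, w k * d k) := by
  apply Real.le_sqrt_of_sq_le
  have h := Finset.sum_sq_le_sum_mul_sum_of_sq_le_mul s (r := fun k => w k * √(d k)) hw
    (fun k hk => mul_nonneg (hw k hk) (hd k hk)) (fun k hk => by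
      rw [mul_pow, Real.sq_sqrt (hd k hk), sq, mul_assoc])
  rwa [hw1, one_mul] at h

/-- **Bernstein approximation error bound under a Lipschitz condition.**  If
`|f(x) - f(y)| ≤ L ‖x - y‖₂` on `[0,1]ⁿ` (Euclidean norm), then for all positive degrees
`m₁, …, mₙ` and all `x ∈ [0,1]ⁿ`,
`|B_{m₁,…,mₙ}(f)(x) - f(x)| ≤ (L/2) (∑ⱼ 1/mⱼ)^{1/2}`. -/
theorem mvBernstein_lipschitz_error_bound {n : ℕ} (f : (Fin n → ℝ) → ℝ) (L : ℝ)
    (hL : ∀ x ∈ Set.Icc (0 : Fin n → ℝ) 1, ∀ y ∈ Set.Icc (0 : Fin n → ℝ) 1,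
      |f x - f y| ≤ L * Real.sqrt (∑ j, (x j - y j) ^ 2))
    (m : Fin n → ℕ) (hm : ∀ j, 0 < m j)
    (x : Fin n → ℝ) (hx : x ∈ Set.Icc (0 : Fin n → ℝ) 1) :
    |mvBernstein m f x - f x| ≤ L / 2 * Real.sqrt (∑ j, 1 / (m j : ℝ)) := by
  rcases Nat.eq_zero_or_pos n with rfl | hn
  · simp [mvBernstein, Subsingleton.elim _ x]
  have hL0 : 0 ≤ L := by
    have h := (abs_nonneg _).trans (hL 1 (by simp) 0 (by simp))
    have hs : 0 < √(∑ j : Fin n, ((1 : Fin n → ℝ) j - (0 : Fin n → ℝ) j) ^ 2) := by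
      simpa using hn
    exact nonneg_of_mul_nonneg_left h hs
  set S := Fintype.piFinset (fun j => Finset.range (m j + 1))
  set w : (Fin n → ℕ) → ℝ := fun k => ∏ j, bernsteinWeight (m j) (k j) (x j)
  set d : (Fin n → ℕ) → ℝ := fun k => ∑ j, ((k j : ℝ) / m j - x j) ^ 2
  have hw : ∀ k, 0 ≤ w k := fun k =>
    Finset.prod_nonneg fun j _ => bernsteinWeight_nonneg _ _ (hx.1 j) (hx.2 j)
  have hw1 : ∑ k ∈ S, w k = 1 := by
    refine (Finset.prod_univ_sum _ fun j a => bernsteinWeight (m j) a (x j)).symm.trans ?_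
    simp [sum_bernsteinWeight]
  have hvar : ∑ k ∈ S, w k * d k = ∑ j, x j * (1 - x j) / m j := by
    simp only [d, Finset.mul_sum]
    rw [Finset.sum_comm]
    refine Finset.sum_congr rfl fun i _ => ?_
    rw [← sum_bernsteinWeight_mul_sq (hm i)]
    exact sum_piFinset_prod_mul_apply _ (fun j a => bernsteinWeight (m j) a (x j)) i
      (fun j _ => sum_bernsteinWeight _ _) (fun a => ((a : ℝ) / m i - x i) ^ 2)
  have hvar_le : ∑ k ∈ S, w k * d k ≤ (1 / 2) ^ 2 * ∑ j, 1 / (m j : ℝ) := by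
    rw [hvar, Finset.mul_sum]
    refine Finset.sum_le_sum fun j _ => ?_
    rw [mul_one_div]
    gcongr
    nlinarith [sq_nonneg (x j - 1 / 2)]
  have hnode : ∀ k ∈ S, (fun j => (k j : ℝ) / (m j : ℝ)) ∈ Set.Icc (0 : Fin n → ℝ) 1 := by
    intro k hk
    refine ⟨fun j => by simp only [Pi.zero_apply]; positivity,
      fun j => div_le_one_of_le₀ ?_ (Nat.cast_nonneg _)⟩
    exact Nat.cast_le.mpr <| Nat.lt_succ_iff.mp (Finset.mem_range.mp (Fintype.mem_piFinset.mp hk j))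
  have hdiff : mvBernstein m f x - f x =
      ∑ k ∈ S, w k * (f (fun j => (k j : ℝ) / (m j : ℝ)) - f x) := by
    simp only [mul_sub, Finset.sum_sub_distrib, ← Finset.sum_mul, hw1, one_mul]
    simp only [mvBernstein, S, w, bernsteinWeight, mul_comm]
  calc |mvBernstein m f x - f x|
      ≤ ∑ k ∈ S, w k * (L * √(d k)) := by
        rw [hdiff]
        refine (Finset.abs_sum_le_sum_abs _ _).trans (Finset.sum_le_sum fun k hk => ?_)
        rw [abs_mul, abs_of_nonneg (hw k)]
        exact mul_le_mul_of_nonneg_left (hL _ (hnode k hk) x hx) (hw k)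
    _ = L * ∑ k ∈ S, w k * √(d k) := by
        rw [Finset.mul_sum]
        exact Finset.sum_congr rfl fun k _ => mul_left_comm _ _ _
    _ ≤ L * √((1 / 2) ^ 2 * ∑ j, 1 / (m j : ℝ)) := by
        gcongr
        exact (sum_mul_sqrt_le_sqrt_sum_mul S w d (fun k _ => hw k) hw1
          fun k _ => Finset.sum_nonneg fun j _ => sq_nonneg _).trans (Real.sqrt_le_sqrt hvar_le)
    _ = L / 2 * √(∑ j, 1 / (m j : ℝ)) := by
        rw [Real.sqrt_mul (by positivity), Real.sqrt_sq (by norm_num)]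
        ring
end

section
/- Ellipsoid-certificate criterion for local dissipativity: Let f : R^n x R^m -> R^n and h : R^n x R^m -> R^p be k times continuously differentiable with f(0,0) = 0 and h(0,0) = 0. Let X = {x in R^n : g_i(x) <= 0, i = 1,...,I_X} and U = {u in R^m : g'_j(u) <= 0, j = 1,...,I_U} for polynomials g_i, g'_j, and let w(u, y) be a polynomial supply rate. For each component write f_i(x,u) = p_i(x,u) + sum over (beta_1, beta_2) with |beta_1| + |beta_2| = k of R_{i;beta_1,beta_2}(x,u) * x^{beta_1} * u^{beta_2}, where p_i is the Taylor polynomial of f_i of order k-1 at (0,0), and similarly h_j(x,u) = q_j(x,u) + sum over (delta_1, delta_2) with |delta_1| + |delta_2| = k of T_{j;delta_1,delta_2}(x,u) * x^{delta_1} * u^{delta_2}; assume constants rbar_{i;beta_1,beta_2}, tbar_{j;delta_1,delta_2} satisfy |R_{i;beta_1,beta_2}(x,u)| <= rbar_{i;beta_1,beta_2} and |T_{j;delta_1,delta_2}(x,u)| <= tbar_{j;delta_1,delta_2} for all (x,u) in X x U, and set rbar_i = sum of rbar_{i;beta_1,beta_2}^2 over (beta_1,beta_2) and tbar_j = sum of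 tbar_{j;delta_1,delta_2}^2 over (delta_1,delta_2). Suppose there exist a polynomial V(x) and nonnegative polynomials s_{1;i}(x), s_{2;i}(x,u), s_{3;j}(x,u), s_{4;i}(x,u), s_{5;j}(x,u) such that for all real x, u and all real scalars r_{i;beta_1,beta_2}, t_{j;delta_1,delta_2}: (a) V(x) + sum_i s_{1;i}(x) g_i(x) >= 0, and (b) - sum over i = 1,...,n of (partial V / partial x_i)(x) * ( p_i(x,u) + sum_{|beta_1|+|beta_2|=k} r_{i;beta_1,beta_2} x^{beta_1} u^{beta_2} ) + w(u, yhat) - sum_i s_{2;i}(x,u) * ( rbar_i - sum_{(beta_1,beta_2)} r_{i;beta_1,beta_2}^2 ) - sum_j s_{3;j}(x,u) * ( tbar_j - sum_{(delta_1,delta_2)} t_{j;delta_1,delta_2}^2 ) + sum_i s_{4;i}(x,u) g_i(x) + sum_j s_{5;j}(x,u) g'_j(u) >= 0, where yhat_j = q_j(x,u) + sum_{|delta_1|+|delta_2|=k} t_{j;delta_1,delta_2} x^{delta_1} u^{delta_2}. Then V(x) >= 0 for all x in X, and along every trajectory of x' = f(x,u), y = h(x,u) with u(t) in U and x(t) in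 X for all t, the dissipation inequality V(x(t_1)) - V(x(t_0)) <= integral from t_0 to t_1 of w(u(t), y(t)) dt holds for all t_0 <= t_1. -/
open Finset

/-- Partial derivative of `g : ℝⁿ → ℝ` in the `j`-th coordinate direction. -/
noncomputable def pder {n : ℕ} (j : Fin n) (g : (Fin n → ℝ) → ℝ) : (Fin n → ℝ) → ℝ :=
  fun x => deriv (fun t : ℝ => g (Function.update x j t)) (x j)

/-- Iterated partial derivative `D^α g` for a multi-index `α : Fin n → ℕ`. -/
noncomputable def mder {n : ℕ} (α : Fin n → ℕ) (g : (Fin n → ℝ) → ℝ) : (Fin n → ℝ) → ℝ :=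
  (List.finRange n).foldr (fun j h => (pder j)^[α j] h) g

/-- Mixed iterated partial derivative `D^α_x D^β_u g` of a two-argument function. -/
noncomputable def mder2 {n m : ℕ} (α : Fin n → ℕ) (β : Fin m → ℕ)
    (g : (Fin n → ℝ) → (Fin m → ℝ) → ℝ) (x : Fin n → ℝ) (u : Fin m → ℝ) : ℝ :=
  mder β (fun v => mder α (fun z => g z v) x) u

/-- Multi-index factorial `α! = α₁! ⋯ αₙ!`. -/
def mfact {n : ℕ} (α : Fin n → ℕ) : ℕ := ∏ j, Nat.factorial (α j)

/-- Multi-index power `x^α = x₁^{α₁} ⋯ xₙ^{αₙ}`. -/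
def mpow {n : ℕ} (x : Fin n → ℝ) (α : Fin n → ℕ) : ℝ := ∏ j, x j ^ α j

/-- Pairs of multi-indices `(α, β)` with `|α| + |β| ≤ d`. -/
def pairLe (n m d : ℕ) : Finset ((Fin n → ℕ) × (Fin m → ℕ)) :=
  (((Fintype.piFinset fun _ => Finset.range (d + 1)) ×ˢ
      (Fintype.piFinset fun _ => Finset.range (d + 1))).filter
    fun ab => (∑ j, ab.1 j) + (∑ j, ab.2 j) ≤ d)

/-- Pairs of multi-indices `(α, β)` with `|α| + |β| = d`. -/
def pairEq (n m d : ℕ) : Finset ((Fin n → ℕ) × (Fin m → ℕ)) :=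
  (((Fintype.piFinset fun _ => Finset.range (d + 1)) ×ˢ
      (Fintype.piFinset fun _ => Finset.range (d + 1))).filter
    fun ab => (∑ j, ab.1 j) + (∑ j, ab.2 j) = d)

/-- The Taylor polynomial of order `d` of `g(x,u)` at `(0,0)`. -/
noncomputable def taylorPoly2 {n m : ℕ} (d : ℕ)
    (g : (Fin n → ℝ) → (Fin m → ℝ) → ℝ) (x : Fin n → ℝ) (u : Fin m → ℝ) : ℝ :=
  ∑ ab ∈ pairLe n m d,
    mder2 ab.1 ab.2 g 0 0 / ((mfact ab.1 : ℝ) * (mfact ab.2 : ℝ)) *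
      mpow x ab.1 * mpow u ab.2

/-- `g : ℝⁿ → ℝ` is a polynomial function. -/
def IsPolyFun {n : ℕ} (g : (Fin n → ℝ) → ℝ) : Prop :=
  ∃ q : MvPolynomial (Fin n) ℝ, ∀ x, g x = MvPolynomial.eval x q

/-- `g : ℝⁿ × ℝᵐ → ℝ` is a polynomial function. -/
def IsPolyFun2 {n m : ℕ} (g : (Fin n → ℝ) → (Fin m → ℝ) → ℝ) : Prop :=
  ∃ q : MvPolynomial (Fin n ⊕ Fin m) ℝ, ∀ x u, g x u = MvPolynomial.eval (Sum.elim x u) q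

theorem MvPolynomial.differentiable_eval {σ : Type*} [Fintype σ] (q : MvPolynomial σ ℝ) :
    Differentiable ℝ (fun x : σ → ℝ => MvPolynomial.eval x q) := by
  induction q using MvPolynomial.induction_on with
  | C a => simp
  | add p q hp hq =>
    simp only [map_add]
    exact hp.add hq
  | mul_X p i hp =>
    simp only [map_mul, MvPolynomial.eval_X]
    exact hp.mul (differentiable_apply i)

theorem IsPolyFun.differentiable {n : ℕ} {g : (Fin n → ℝ) → ℝ} (hg : IsPolyFun g) :
    Differentiable ℝ g := by
  obtain ⟨q, hq⟩ := hg
  rw [funext hq]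
  exact q.differentiable_eval

theorem pder_eq_fderiv {n : ℕ} {g : (Fin n → ℝ) → ℝ} {x : Fin n → ℝ}
    (hg : DifferentiableAt ℝ g x) (j : Fin n) : pder j g x = fderiv ℝ g x (Pi.single j 1) := by
  have hg' : HasFDerivAt g (fderiv ℝ g x) (Function.update x j (x j)) := by
    simpa using hg.hasFDerivAt
  exact (hg'.comp_hasDerivAt (x j) (hasDerivAt_update x j (x j))).deriv

theorem hasDerivAt_comp_sum_pder {n : ℕ} {g : (Fin n → ℝ) → ℝ} {x : ℝ → Fin n → ℝ}
    {v : Fin n → ℝ} {t : ℝ} (hg : DifferentiableAt ℝ g (x t)) (hx : HasDerivAt x v t) :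
    HasDerivAt (fun s => g (x s)) (∑ i, pder i g (x t) * v i) t := by
  have hsum : ∑ i, pder i g (x t) * v i = fderiv ℝ g (x t) v := by
    simp only [pder_eq_fderiv hg]
    conv_rhs => rw [pi_eq_sum_univ' v, map_sum]
    exact Finset.sum_congr rfl fun i _ => by simp [mul_comm]
  rw [hsum]
  exact hg.hasFDerivAt.comp_hasDerivAt t hx

theorem sum_mul_nonpos {ι : Type*} [Fintype ι] {a b : ι → ℝ} (ha : ∀ i, 0 ≤ a i)
    (hb : ∀ i, b i ≤ 0) : ∑ i, a i * b i ≤ 0 :=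
  Finset.sum_nonpos fun i _ => mul_nonpos_of_nonneg_of_nonpos (ha i) (hb i)

theorem sum_mul_sum_sq_sub_nonneg {ι κ : Type*} [Fintype ι] {S : Finset κ} {c : ι → ℝ}
    {a b : ι → κ → ℝ} (hc : ∀ i, 0 ≤ c i) (hab : ∀ i, ∀ k ∈ S, |a i k| ≤ b i k) :
    0 ≤ ∑ i, c i * ((∑ k ∈ S, b i k ^ 2) - ∑ k ∈ S, a i k ^ 2) := by
  refine Finset.sum_nonneg fun i _ => mul_nonneg (hc i) (sub_nonneg.2 ?_)
  exact Finset.sum_le_sum fun k hk => sq_le_sq.2 ((hab i k hk).trans (le_abs_self _))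

/-- **Ellipsoid-certificate criterion for local dissipativity.** -/
theorem ellipsoid_certificate_local_dissipativity
    {n m p k IX IU : ℕ} (hk : 0 < k)
    (f : (Fin n → ℝ) → (Fin m → ℝ) → (Fin n → ℝ))
    (h : (Fin n → ℝ) → (Fin m → ℝ) → (Fin p → ℝ))
    (hf : ContDiff ℝ ((k : ℕ) : ℕ∞) (Function.uncurry f))
    (hh : ContDiff ℝ ((k : ℕ) : ℕ∞) (Function.uncurry h))
    (hf0 : f 0 0 = 0) (hh0 : h 0 0 = 0)
    (gX : Fin IX → (Fin n → ℝ) → ℝ) (hgX : ∀ i, IsPolyFun (gX i))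
    (gU : Fin IU → (Fin m → ℝ) → ℝ) (hgU : ∀ j, IsPolyFun (gU j))
    (w : (Fin m → ℝ) → (Fin p → ℝ) → ℝ) (hw : IsPolyFun2 w)
    (R : Fin n → ((Fin n → ℕ) × (Fin m → ℕ)) → (Fin n → ℝ) → (Fin m → ℝ) → ℝ)
    (hfdec : ∀ i x u, f x u i =
      taylorPoly2 (k - 1) (fun a b => f a b i) x u +
        ∑ ab ∈ pairEq n m k, R i ab x u * mpow x ab.1 * mpow u ab.2)
    (T : Fin p → ((Fin n → ℕ) × (Fin m → ℕ)) → (Fin n → ℝ) → (Fin m → ℝ) → ℝ)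
    (hhdec : ∀ j x u, h x u j =
      taylorPoly2 (k - 1) (fun a b => h a b j) x u +
        ∑ ab ∈ pairEq n m k, T j ab x u * mpow x ab.1 * mpow u ab.2)
    (rbar : Fin n → ((Fin n → ℕ) × (Fin m → ℕ)) → ℝ)
    (hrbar : ∀ i, ∀ ab ∈ pairEq n m k, ∀ x, (∀ i', gX i' x ≤ 0) →
      ∀ u, (∀ j', gU j' u ≤ 0) → |R i ab x u| ≤ rbar i ab)
    (tbar : Fin p → ((Fin n → ℕ) × (Fin m → ℕ)) → ℝ)
    (htbar : ∀ j, ∀ ab ∈ pairEq n m k, ∀ x, (∀ i', gX i' x ≤ 0) →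
      ∀ u, (∀ j', gU j' u ≤ 0) → |T j ab x u| ≤ tbar j ab)
    (V : (Fin n → ℝ) → ℝ) (hV : IsPolyFun V)
    (s₁ : Fin IX → (Fin n → ℝ) → ℝ)
    (hs₁ : ∀ i, IsPolyFun (s₁ i) ∧ ∀ x, 0 ≤ s₁ i x)
    (s₂ : Fin n → (Fin n → ℝ) → (Fin m → ℝ) → ℝ)
    (hs₂ : ∀ i, IsPolyFun2 (s₂ i) ∧ ∀ x u, 0 ≤ s₂ i x u)
    (s₃ : Fin p → (Fin n → ℝ) → (Fin m → ℝ) → ℝ)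
    (hs₃ : ∀ j, IsPolyFun2 (s₃ j) ∧ ∀ x u, 0 ≤ s₃ j x u)
    (s₄ : Fin IX → (Fin n → ℝ) → (Fin m → ℝ) → ℝ)
    (hs₄ : ∀ i, IsPolyFun2 (s₄ i) ∧ ∀ x u, 0 ≤ s₄ i x u)
    (s₅ : Fin IU → (Fin n → ℝ) → (Fin m → ℝ) → ℝ)
    (hs₅ : ∀ j, IsPolyFun2 (s₅ j) ∧ ∀ x u, 0 ≤ s₅ j x u)
    -- certificate condition (a)
    (ha : ∀ x : Fin n → ℝ, 0 ≤ V x + ∑ i, s₁ i x * gX i x)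
    -- certificate condition (b): the ellipsoid bound on the remainder coefficients
    (hb : ∀ (x : Fin n → ℝ) (u : Fin m → ℝ)
        (r : Fin n → ((Fin n → ℕ) × (Fin m → ℕ)) → ℝ)
        (t : Fin p → ((Fin n → ℕ) × (Fin m → ℕ)) → ℝ),
      0 ≤
        -(∑ i, pder i V x *
            (taylorPoly2 (k - 1) (fun a b => f a b i) x u +
              ∑ ab ∈ pairEq n m k, r i ab * mpow x ab.1 * mpow u ab.2)) +
          w u (fun j =>
            taylorPoly2 (k - 1) (fun a b => h a b j) x u +
              ∑ ab ∈ pairEq n m k, t j ab * mpow x ab.1 * mpow u ab.2) -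
          (∑ i, s₂ i x u *
            ((∑ ab ∈ pairEq n m k, rbar i ab ^ 2) - ∑ ab ∈ pairEq n m k, r i ab ^ 2)) -
          (∑ j, s₃ j x u *
            ((∑ ab ∈ pairEq n m k, tbar j ab ^ 2) - ∑ ab ∈ pairEq n m k, t j ab ^ 2)) +
          (∑ i, s₄ i x u * gX i x) + ∑ j, s₅ j x u * gU j u) :
    (∀ x : Fin n → ℝ, (∀ i, gX i x ≤ 0) → 0 ≤ V x) ∧
      ∀ (xtr : ℝ → (Fin n → ℝ)) (utr : ℝ → (Fin m → ℝ)),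
        (∀ t, HasDerivAt xtr (f (xtr t) (utr t)) t) →
        (∀ t j, gU j (utr t) ≤ 0) →
        (∀ t i, gX i (xtr t) ≤ 0) →
        ∀ t₀ t₁ : ℝ, t₀ ≤ t₁ →
        IntervalIntegrable (fun t => w (utr t) (h (xtr t) (utr t)))
          MeasureTheory.volume t₀ t₁ →
        V (xtr t₁) - V (xtr t₀) ≤ ∫ t in t₀..t₁, w (utr t) (h (xtr t) (utr t)) := by
  refine ⟨fun x hx => ?_, fun xtr utr hxtr hU hX t₀ t₁ ht hint => ?_⟩
  · linarith [ha x, sum_mul_nonpos (fun i => (hs₁ i).2 x) hx]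
  have hderiv : ∀ t, HasDerivAt (fun s => V (xtr s))
      (∑ i, pder i V (xtr t) * f (xtr t) (utr t) i) t := fun t =>
    hasDerivAt_comp_sum_pder (hV.differentiable _) (hxtr t)
  have hle : ∀ t, ∑ i, pder i V (xtr t) * f (xtr t) (utr t) i ≤
      w (utr t) (h (xtr t) (utr t)) := by
    intro t
    have hcert := hb (xtr t) (utr t) (fun i ab => R i ab (xtr t) (utr t))
      (fun j ab => T j ab (xtr t) (utr t))
    simp only [← hfdec, ← hhdec] at hcert
    linarith [sum_mul_sum_sq_sub_nonneg (fun i => (hs₂ i).2 (xtr t) (utr t))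
        (fun i ab hab => hrbar i ab hab (xtr t) (hX t) (utr t) (hU t)),
      sum_mul_sum_sq_sub_nonneg (fun j => (hs₃ j).2 (xtr t) (utr t))
        (fun j ab hab => htbar j ab hab (xtr t) (hX t) (utr t) (hU t)),
      sum_mul_nonpos (fun i => (hs₄ i).2 (xtr t) (utr t)) (hX t),
      sum_mul_nonpos (fun j => (hs₅ j).2 (xtr t) (utr t)) (hU t)]
  exact intervalIntegral.sub_le_integral_of_hasDeriv_right_of_le ht
    (fun t _ => (hderiv t).continuousAt.continuousWithinAt)
    (fun t _ => (hderiv t).hasDerivWithinAt)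
    ((intervalIntegrable_iff_integrableOn_Icc_of_le ht).1 hint) (fun t _ => hle t)
end

section
/- Output feedback passivity index via the ellipsoid certificate: Under the hypotheses of the ellipsoid-certificate criterion for local dissipativity (f, h k times continuously differentiable vanishing at the origin; X and U semialgebraic sets defined by polynomial inequalities g_i(x) <= 0 and g'_j(u) <= 0; Taylor decompositions of f and h of order k-1 with remainder coefficient functions bounded on X x U by constants rbar and tbar), suppose the certificate conditions of that criterion hold with the supply rate w(u, y) = u^T y - rho * y^T y for some real number rho, witnessed by a polynomial V and nonnegative polynomial multipliers. Then the system x' = f(x,u), y = h(x,u) is locally output feedback passive with index rho: V >= 0 on X, and along every trajectory with u(t) in U and x(t) in X for all t, the inequality integral from 0 to T of u(t)^T y(t) dt >= V(x(T)) - V(x(0)) + rho * integral from 0 to T of y(t)^T y(t) dt holds for all T >= 0. -/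
open Finset

/-- The output-feedback-passivity supply rate `w(u, y) = uᵀy - ρ yᵀy`. -/
def supplyOFP {m : ℕ} (ρ : ℝ) (u y : Fin m → ℝ) : ℝ :=
  (∑ j, u j * y j) - ρ * ∑ j, y j * y j

/-- Chain rule along a curve in terms of coordinate partial derivatives. -/
theorem hasDerivAt_comp_pder {n : ℕ} {g : (Fin n → ℝ) → ℝ} {c : ℝ → Fin n → ℝ}
    {v : Fin n → ℝ} {t : ℝ} (hg : DifferentiableAt ℝ g (c t)) (hc : HasDerivAt c v t) :
    HasDerivAt (fun s => g (c s)) (∑ i, pder i g (c t) * v i) t := by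
  have hsum : fderiv ℝ g (c t) v = ∑ i, pder i g (c t) * v i := by
    conv_lhs => rw [pi_eq_sum_univ' v]
    simp only [map_sum, map_smul, smul_eq_mul, pder_eq_fderiv hg]
    exact Finset.sum_congr rfl fun i _ => mul_comm _ _
  exact hsum ▸ hg.hasFDerivAt.comp_hasDerivAt t hc

/-- A function bounded in absolute value by `b` termwise lies in the ellipsoid given by `b`. -/
theorem sum_sq_le_sum_sq_of_abs_le {ι : Type*} {s : Finset ι} {a b : ι → ℝ}
    (hab : ∀ i ∈ s, |a i| ≤ b i) : ∑ i ∈ s, a i ^ 2 ≤ ∑ i ∈ s, b i ^ 2 :=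
  Finset.sum_le_sum fun i hi => sq_le_sq.2 ((hab i hi).trans (le_abs_self _))

/-- **Output feedback passivity index via the ellipsoid certificate.** -/
theorem ofp_index_via_ellipsoid_certificate
    {n m k IX IU : ℕ} (hk : 0 < k) (ρ : ℝ)
    (f : (Fin n → ℝ) → (Fin m → ℝ) → (Fin n → ℝ))
    (h : (Fin n → ℝ) → (Fin m → ℝ) → (Fin m → ℝ))
    (hf : ContDiff ℝ ((k : ℕ) : ℕ∞) (Function.uncurry f))
    (hh : ContDiff ℝ ((k : ℕ) : ℕ∞) (Function.uncurry h))
    (hf0 : f 0 0 = 0) (hh0 : h 0 0 = 0)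
    (gX : Fin IX → (Fin n → ℝ) → ℝ) (hgX : ∀ i, IsPolyFun (gX i))
    (gU : Fin IU → (Fin m → ℝ) → ℝ) (hgU : ∀ j, IsPolyFun (gU j))
    (R : Fin n → ((Fin n → ℕ) × (Fin m → ℕ)) → (Fin n → ℝ) → (Fin m → ℝ) → ℝ)
    (hfdec : ∀ i x u, f x u i =
      taylorPoly2 (k - 1) (fun a b => f a b i) x u +
        ∑ ab ∈ pairEq n m k, R i ab x u * mpow x ab.1 * mpow u ab.2)
    (T : Fin m → ((Fin n → ℕ) × (Fin m → ℕ)) → (Fin n → ℝ) → (Fin m → ℝ) → ℝ)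
    (hhdec : ∀ j x u, h x u j =
      taylorPoly2 (k - 1) (fun a b => h a b j) x u +
        ∑ ab ∈ pairEq n m k, T j ab x u * mpow x ab.1 * mpow u ab.2)
    (rbar : Fin n → ((Fin n → ℕ) × (Fin m → ℕ)) → ℝ)
    (hrbar : ∀ i, ∀ ab ∈ pairEq n m k, ∀ x, (∀ i', gX i' x ≤ 0) →
      ∀ u, (∀ j', gU j' u ≤ 0) → |R i ab x u| ≤ rbar i ab)
    (tbar : Fin m → ((Fin n → ℕ) × (Fin m → ℕ)) → ℝ)
    (htbar : ∀ j, ∀ ab ∈ pairEq n m k, ∀ x, (∀ i', gX i' x ≤ 0) →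
      ∀ u, (∀ j', gU j' u ≤ 0) → |T j ab x u| ≤ tbar j ab)
    (V : (Fin n → ℝ) → ℝ) (hV : IsPolyFun V)
    (s₁ : Fin IX → (Fin n → ℝ) → ℝ)
    (hs₁ : ∀ i, IsPolyFun (s₁ i) ∧ ∀ x, 0 ≤ s₁ i x)
    (s₂ : Fin n → (Fin n → ℝ) → (Fin m → ℝ) → ℝ)
    (hs₂ : ∀ i, IsPolyFun2 (s₂ i) ∧ ∀ x u, 0 ≤ s₂ i x u)
    (s₃ : Fin m → (Fin n → ℝ) → (Fin m → ℝ) → ℝ)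
    (hs₃ : ∀ j, IsPolyFun2 (s₃ j) ∧ ∀ x u, 0 ≤ s₃ j x u)
    (s₄ : Fin IX → (Fin n → ℝ) → (Fin m → ℝ) → ℝ)
    (hs₄ : ∀ i, IsPolyFun2 (s₄ i) ∧ ∀ x u, 0 ≤ s₄ i x u)
    (s₅ : Fin IU → (Fin n → ℝ) → (Fin m → ℝ) → ℝ)
    (hs₅ : ∀ j, IsPolyFun2 (s₅ j) ∧ ∀ x u, 0 ≤ s₅ j x u)
    -- certificate condition (a)
    (ha : ∀ x : Fin n → ℝ, 0 ≤ V x + ∑ i, s₁ i x * gX i x)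
    -- certificate condition (b) with the supply rate `w(u,y) = uᵀy - ρ yᵀy`
    (hb : ∀ (x : Fin n → ℝ) (u : Fin m → ℝ)
        (r : Fin n → ((Fin n → ℕ) × (Fin m → ℕ)) → ℝ)
        (t : Fin m → ((Fin n → ℕ) × (Fin m → ℕ)) → ℝ),
      0 ≤
        -(∑ i, pder i V x *
            (taylorPoly2 (k - 1) (fun a b => f a b i) x u +
              ∑ ab ∈ pairEq n m k, r i ab * mpow x ab.1 * mpow u ab.2)) +
          supplyOFP ρ u (fun j =>
            taylorPoly2 (k - 1) (fun a b => h a b j) x u +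
              ∑ ab ∈ pairEq n m k, t j ab * mpow x ab.1 * mpow u ab.2) -
          (∑ i, s₂ i x u *
            ((∑ ab ∈ pairEq n m k, rbar i ab ^ 2) - ∑ ab ∈ pairEq n m k, r i ab ^ 2)) -
          (∑ j, s₃ j x u *
            ((∑ ab ∈ pairEq n m k, tbar j ab ^ 2) - ∑ ab ∈ pairEq n m k, t j ab ^ 2)) +
          (∑ i, s₄ i x u * gX i x) + ∑ j, s₅ j x u * gU j u) :
    -- conclusion: the system is locally output feedback passive with index `ρ`
    (∀ x : Fin n → ℝ, (∀ i, gX i x ≤ 0) → 0 ≤ V x) ∧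
      ∀ (xtr : ℝ → (Fin n → ℝ)) (utr : ℝ → (Fin m → ℝ)),
        (∀ t, HasDerivAt xtr (f (xtr t) (utr t)) t) →
        (∀ t j, gU j (utr t) ≤ 0) →
        (∀ t i, gX i (xtr t) ≤ 0) →
        ∀ T' : ℝ, 0 ≤ T' →
        IntervalIntegrable
          (fun t => ∑ j, utr t j * h (xtr t) (utr t) j) MeasureTheory.volume 0 T' →
        IntervalIntegrable
          (fun t => ∑ j, h (xtr t) (utr t) j * h (xtr t) (utr t) j)
          MeasureTheory.volume 0 T' →
        V (xtr T') - V (xtr 0) +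
            ρ * ∫ t in (0 : ℝ)..T', ∑ j, h (xtr t) (utr t) j * h (xtr t) (utr t) j ≤
          ∫ t in (0 : ℝ)..T', ∑ j, utr t j * h (xtr t) (utr t) j := by
  refine ⟨fun x hx => ?_, fun xtr utr hder hU hX T' hT' hint₁ hint₂ => ?_⟩
  · have h₁ : ∑ i, s₁ i x * gX i x ≤ 0 :=
      Finset.sum_nonpos fun i _ => mul_nonpos_of_nonneg_of_nonpos ((hs₁ i).2 x) (hx i)
    linarith [ha x]
  have key : ∀ x u, (∀ i, gX i x ≤ 0) → (∀ j, gU j u ≤ 0) →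
      ∑ i, pder i V x * f x u i ≤ supplyOFP ρ u (h x u) := by
    intro x u hx hu
    have hcert := hb x u (fun i ab => R i ab x u) (fun j ab => T j ab x u)
    simp only [← hfdec, ← hhdec] at hcert
    have h₂ : 0 ≤ ∑ i, s₂ i x u * ((∑ ab ∈ pairEq n m k, rbar i ab ^ 2) -
        ∑ ab ∈ pairEq n m k, R i ab x u ^ 2) :=
      Finset.sum_nonneg fun i _ => mul_nonneg ((hs₂ i).2 x u) <| sub_nonneg.2 <|
        sum_sq_le_sum_sq_of_abs_le fun ab hab => hrbar i ab hab x hx u hu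
    have h₃ : 0 ≤ ∑ j, s₃ j x u * ((∑ ab ∈ pairEq n m k, tbar j ab ^ 2) -
        ∑ ab ∈ pairEq n m k, T j ab x u ^ 2) :=
      Finset.sum_nonneg fun j _ => mul_nonneg ((hs₃ j).2 x u) <| sub_nonneg.2 <|
        sum_sq_le_sum_sq_of_abs_le fun ab hab => htbar j ab hab x hx u hu
    have h₄ : ∑ i, s₄ i x u * gX i x ≤ 0 :=
      Finset.sum_nonpos fun i _ => mul_nonpos_of_nonneg_of_nonpos ((hs₄ i).2 x u) (hx i)
    have h₅ : ∑ j, s₅ j x u * gU j u ≤ 0 :=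
      Finset.sum_nonpos fun j _ => mul_nonpos_of_nonneg_of_nonpos ((hs₅ j).2 x u) (hu j)
    linarith
  have hVder : ∀ t, HasDerivAt (fun s => V (xtr s))
      (∑ i, pder i V (xtr t) * f (xtr t) (utr t) i) t :=
    fun t => hasDerivAt_comp_pder (hV.differentiable _) (hder t)
  have hint := hint₁.sub (hint₂.const_mul ρ)
  have hle := intervalIntegral.sub_le_integral_of_hasDeriv_right_of_le hT'
    (fun t _ => (hVder t).continuousAt.continuousWithinAt)
    (fun t _ => (hVder t).hasDerivWithinAt)
    ((intervalIntegrable_iff_integrableOn_Icc_of_le hT').1 hint)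
    (fun t _ => key _ _ (hX t) (hU t))
  rw [intervalIntegral.integral_sub hint₁ (hint₂.const_mul ρ),
    intervalIntegral.integral_const_mul] at hle
  linarith
end
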